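/- Let D ⊂ ℝ^d satisfy Assumption (D) with data (ε₀, η, n). There exists a constant C > 0 such that for all x, x' ∈ ∂D, all A ∈ I_x and A' ∈ I_{x'}: (ii) for all y, z ∈ ℝ^d such that x+Ay ∈ D, x'+A'y ∈ D, x+Az ∉ D and x'+A'z ∈ D, | |Λ(x+Ay, x+Az) − (x'+A'z)| − |x−x'| | ≤ C ρ(x,x',A,A') ( min(|z|,1) + |y| min(|y−z|,1) / δ(x+Ay) ); and (iv) for all z ∈ ℝ^d, | |Λ(x, x+Az) − Λ(x', x'+A'z)| − |x−x'| | ≤ C. -/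

import Mathlib

open Metric Set Bornology
open scoped RealInnerProductSpace

noncomputable section

/-- The first vector of the canonical basis of `ℝ^d`. -/
def e1 (d : ℕ) : EuclideanSpace ℝ (Fin d) :=
  if h : 0 < d then EuclideanSpace.single (⟨0, h⟩ : Fin d) 1 else 0

/-- The projection `ℝ^d → ℝ^{d−1}`, `u ↦ (u·e₂, …, u·e_d)`. -/
def projTail (d : ℕ) (u : EuclideanSpace ℝ (Fin d)) :
    EuclideanSpace ℝ (Fin (d - 1)) :=
  (EuclideanSpace.equiv (Fin (d - 1)) ℝ).symm fun i => u ⟨i.1 + 1, by have := i.isLt; omega⟩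

/-- Assumption (D): `D ⊂ ℝ^d` (`d ≥ 2`) is nonempty, open, bounded and convex, `n x` is a
unit vector for `x ∈ ∂D`, and around each boundary point `x` the domain is, in suitable
isometric coordinates sending `e₁` to `n x`, the epigraph of a `C³` uniformly strongly
convex function `ψ` with `ψ(0)=0`, `∇ψ(0)=0`, `Hess ψ ≥ η`, `‖D²ψ‖+‖D³ψ‖ ≤ η⁻¹`. -/
structure AssumptionD (d : ℕ) (D : Set (EuclideanSpace ℝ (Fin d))) (ε₀ η : ℝ)
    (n : EuclideanSpace ℝ (Fin d) → EuclideanSpace ℝ (Fin d)) : Prop where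
  dim_ge : 2 ≤ d
  eps_pos : 0 < ε₀
  eps_lt_one : ε₀ < 1
  eta_pos : 0 < η
  nonempty : D.Nonempty
  isOpen : IsOpen D
  isBounded : Bornology.IsBounded D
  convex : Convex ℝ D
  normal_norm : ∀ x ∈ frontier D, ‖n x‖ = 1
  chart : ∀ x ∈ frontier D,
    ∃ A₀ : EuclideanSpace ℝ (Fin d) →ₗᵢ[ℝ] EuclideanSpace ℝ (Fin d),
      A₀ (e1 d) = n x ∧
      ∃ ψ : EuclideanSpace ℝ (Fin (d - 1)) → ℝ,
        ContDiffOn ℝ 3 ψ (Metric.ball (0 : EuclideanSpace ℝ (Fin (d - 1))) ε₀) ∧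
        (∀ v ∈ Metric.ball (0 : EuclideanSpace ℝ (Fin (d - 1))) ε₀, 0 ≤ ψ v) ∧
        ψ 0 = 0 ∧
        fderiv ℝ ψ 0 = 0 ∧
        (∀ v ∈ Metric.ball (0 : EuclideanSpace ℝ (Fin (d - 1))) ε₀,
          ∀ w : EuclideanSpace ℝ (Fin (d - 1)),
            η * ‖w‖ ^ 2 ≤ iteratedFDeriv ℝ 2 ψ v ![w, w]) ∧
        (∀ v ∈ Metric.ball (0 : EuclideanSpace ℝ (Fin (d - 1))) ε₀,
          ‖iteratedFDeriv ℝ 2 ψ v‖ + ‖iteratedFDeriv ℝ 3 ψ v‖ ≤ η⁻¹) ∧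
        D ∩ Metric.ball x ε₀ =
          (fun u : EuclideanSpace ℝ (Fin d) => x + A₀ u) ''
            {u : EuclideanSpace ℝ (Fin d) |
              u ∈ Metric.ball (0 : EuclideanSpace ℝ (Fin d)) ε₀ ∧
              ψ (projTail d u) < ⟪u, e1 d⟫}

/-- `lamT D y z` is the largest `t ∈ [0,1]` such that `y + t • (z - y) ∈ closure D`. -/
def lamT {d : ℕ} (D : Set (EuclideanSpace ℝ (Fin d)))
    (y z : EuclideanSpace ℝ (Fin d)) : ℝ :=
  sSup {t : ℝ | t ∈ Set.Icc (0 : ℝ) 1 ∧ y + t • (z - y) ∈ closure D}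

/-- The cutoff map `Λ`. -/
def Lam {d : ℕ} (D : Set (EuclideanSpace ℝ (Fin d)))
    (y z : EuclideanSpace ℝ (Fin d)) : EuclideanSpace ℝ (Fin d) :=
  y + lamT D y z • (z - y)


section helpers

set_option maxSynthPendingDepth 3

lemma aux_lip {V : Type*} [NormedAddCommGroup V] [NormedSpace ℝ V] (ψ : V → ℝ) (B : Set V)
    (hBo : IsOpen B) (hc : Convex ℝ B) (M : ℝ)
    (hC2 : ContDiffOn ℝ 1 (fderiv ℝ (fderiv ℝ ψ)) B)
    (hb : ∀ v ∈ B, ‖iteratedFDeriv ℝ 3 ψ v‖ ≤ M) :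
    ∀ v ∈ B, ∀ w ∈ B, ‖fderiv ℝ (fderiv ℝ ψ) v - fderiv ℝ (fderiv ℝ ψ) w‖ ≤ M * ‖v - w‖ := by
  have d3 : ∀ v ∈ B, HasFDerivAt (fderiv ℝ (fderiv ℝ ψ)) (fderiv ℝ (fderiv ℝ (fderiv ℝ ψ)) v) v :=
    fun v hv =>
    ((hC2.contDiffAt (hBo.mem_nhds hv)).differentiableAt (by norm_num)).hasFDerivAt
  have b3 : ∀ v ∈ B, ‖fderiv ℝ (fderiv ℝ (fderiv ℝ ψ)) v‖ ≤ M := by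
    intro v hv
    have := hb v hv
    rwa [← norm_iteratedFDeriv_fderiv (n := 2), ← norm_iteratedFDeriv_fderiv (n := 1), ← norm_iteratedFDeriv_fderiv (n := 0), norm_iteratedFDeriv_zero] at this
  intro v hv w hw
  exact Convex.norm_image_sub_le_of_norm_hasFDerivWithin_le
    (fun u hu => (d3 u hu).hasFDerivWithinAt) b3 hc hw hv

lemma aux_taylor (k k1 k2 : ℝ → ℝ) (m : ℝ)
    (h1 : ∀ t ∈ Set.Icc (0:ℝ) 1, HasDerivAt k (k1 t) t)
    (h2 : ∀ t ∈ Set.Icc (0:ℝ) 1, HasDerivAt k1 (k2 t) t)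
    (k0 : k 0 = 0) (k10 : k1 0 = 0) (hm : ∀ t ∈ Set.Icc (0:ℝ) 1, m ≤ k2 t) :
    m / 2 ≤ k 1 := by
  have e1 : ∀ t ∈ Set.Icc (0:ℝ) 1, m * t ≤ k1 t := by
    have hd : ∀ t ∈ Set.Icc (0:ℝ) 1, HasDerivAt (fun t => k1 t - m * t) (k2 t - m * 1) t :=
      fun t ht => (h2 t ht).sub ((hasDerivAt_id t).const_mul m)
    have mono : MonotoneOn (fun t => k1 t - m * t) (Set.Icc (0:ℝ) 1) := by
      apply monotoneOn_of_deriv_nonneg (convex_Icc 0 1)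
      · exact fun t ht => (hd t ht).continuousAt.continuousWithinAt
      · exact fun t ht => (hd t (interior_subset ht)).differentiableAt.differentiableWithinAt
      · intro t ht
        rw [(hd t (interior_subset ht)).deriv]
        linarith [hm t (interior_subset ht)]
    intro t ht
    have := mono (Set.left_mem_Icc.2 zero_le_one) ht ht.1
    simp [k10] at this
    linarith
  have hd : ∀ t ∈ Set.Icc (0:ℝ) 1, HasDerivAt (fun t => k t - m / 2 * t ^ 2) (k1 t - m * t) t := by
    intro t ht
    refine ((h1 t ht).sub ((hasDerivAt_pow 2 t).const_mul (m/2))).congr_deriv ?_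
    norm_num
    ring
  have mono : MonotoneOn (fun t => k t - m / 2 * t ^ 2) (Set.Icc (0:ℝ) 1) := by
    apply monotoneOn_of_deriv_nonneg (convex_Icc 0 1)
    · exact fun t ht => (hd t ht).continuousAt.continuousWithinAt
    · exact fun t ht => (hd t (interior_subset ht)).differentiableAt.differentiableWithinAt
    · intro t ht
      rw [(hd t (interior_subset ht)).deriv]
      linarith [e1 t (interior_subset ht)]
  have := mono (Set.left_mem_Icc.2 zero_le_one) (Set.right_mem_Icc.2 zero_le_one) zero_le_one
  simp [k0] at this
  linarith

lemma aux_proj (d : ℕ) (hd : 2 ≤ d) : ∃ P0 : EuclideanSpace ℝ (Fin d) →L[ℝ] EuclideanSpace ℝ (Fin (d-1)),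
    (∀ u, P0 u = projTail d u) ∧ ∀ u, ‖P0 u‖ ^ 2 + ⟪u, e1 d⟫ ^ 2 = ‖u‖ ^ 2 := by
  obtain ⟨k, rfl⟩ : ∃ k, d = k + 1 := ⟨d - 1, by omega⟩
  let L : EuclideanSpace ℝ (Fin (k+1)) →ₗ[ℝ] EuclideanSpace ℝ (Fin (k+1-1)) :=
    { toFun := projTail (k+1)
      map_add' := by intro u v; ext i; simp [projTail]
      map_smul' := by intro c u; ext i; simp [projTail] }
  refine ⟨LinearMap.toContinuousLinearMap L, fun u => rfl, fun u => ?_⟩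
  have : LinearMap.toContinuousLinearMap L u = projTail (k+1) u := rfl
  rw [this, EuclideanSpace.norm_sq_eq, EuclideanSpace.norm_sq_eq, Fin.sum_univ_succ]
  have h0 : ⟪u, e1 (k+1)⟫ = u 0 := by
    simp [e1, EuclideanSpace.inner_single_right]
  rw [h0]
  simp [projTail]
  rw [add_comm]
  rfl

lemma aux_chart {d : ℕ} {D : Set (EuclideanSpace ℝ (Fin d))} {ε₀ η : ℝ}
    {n : EuclideanSpace ℝ (Fin d) → EuclideanSpace ℝ (Fin d)}
    (hD : AssumptionD d D ε₀ η n) (x : EuclideanSpace ℝ (Fin d)) (hx : x ∈ frontier D) :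
    ∃ (f : EuclideanSpace ℝ (Fin d) → ℝ)
      (F1 : EuclideanSpace ℝ (Fin d) → EuclideanSpace ℝ (Fin d) →L[ℝ] ℝ)
      (F2 : EuclideanSpace ℝ (Fin d) →
        EuclideanSpace ℝ (Fin d) →L[ℝ] EuclideanSpace ℝ (Fin d) →L[ℝ] ℝ),
      (∀ X ∈ ball x ε₀, HasFDerivAt f (F1 X) X) ∧
      (∀ X ∈ ball x ε₀, HasFDerivAt F1 (F2 X) X) ∧
      (∀ X ∈ ball x ε₀, ‖F2 X‖ ≤ η⁻¹) ∧
      (∀ X ∈ ball x ε₀, ∀ Y ∈ ball x ε₀, ‖F2 X - F2 Y‖ ≤ η⁻¹ * ‖X - Y‖) ∧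
      f x = 0 ∧ (∀ w, F1 x w = ⟪w, n x⟫) ∧
      (∀ X ∈ ball x ε₀, X ∈ D ↔ 0 < f X) ∧
      (∀ X ∈ ball x ε₀, f X ≤ ⟪X - x, n x⟫ - η / 2 * (‖X - x‖ ^ 2 - ⟪X - x, n x⟫ ^ 2)) := by
  have hη := hD.eta_pos
  have hε := hD.eps_pos
  obtain ⟨A₀, hA, ψ, hC, -, hψ0, hdψ0, hHess, hbd, hset⟩ := hD.chart x hx
  obtain ⟨P0, hP0, hP0n⟩ := aux_proj d hD.dim_ge
  let Ae : EuclideanSpace ℝ (Fin d) ≃ₗᵢ[ℝ] EuclideanSpace ℝ (Fin d) :=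
    A₀.toLinearIsometryEquiv rfl
  have hAe : ∀ u, Ae u = A₀ u := fun u => rfl
  let P : EuclideanSpace ℝ (Fin d) →L[ℝ] EuclideanSpace ℝ (Fin (d-1)) :=
    P0 ∘L Ae.symm.toLinearIsometry.toContinuousLinearMap
  have hPa : ∀ w, P w = P0 (Ae.symm w) := fun w => rfl
  have hin : ∀ w, ⟪Ae.symm w, e1 d⟫ = ⟪w, n x⟫ := by
    intro w
    rw [← hA, ← hAe, ← Ae.inner_map_map, Ae.apply_symm_apply]
  have hPn : ∀ w, ‖P w‖ ^ 2 + ⟪w, n x⟫ ^ 2 = ‖w‖ ^ 2 := by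
    intro w
    rw [hPa, ← hin, hP0n, Ae.symm.norm_map]
  have hPle : ∀ w, ‖P w‖ ≤ ‖w‖ := by
    intro w
    have := hPn w
    apply le_of_sq_le_sq _ (norm_nonneg _)
    nlinarith [sq_nonneg (⟪w, n x⟫ : ℝ)]
  have hPb : ∀ X ∈ ball x ε₀, P (X - x) ∈ ball (0 : EuclideanSpace ℝ (Fin (d-1))) ε₀ := by
    intro X hX
    rw [mem_ball_zero_iff]
    rw [mem_ball, dist_eq_norm] at hX
    exact (hPle _).trans_lt hX
  set B := ball (0 : EuclideanSpace ℝ (Fin (d-1))) ε₀ with hB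
  have hBo : IsOpen B := isOpen_ball
  have d1 : ∀ v ∈ B, HasFDerivAt ψ (fderiv ℝ ψ v) v := fun v hv =>
    ((hC.contDiffAt (hBo.mem_nhds hv)).differentiableAt (by norm_num)).hasFDerivAt
  have hC1 : ContDiffOn ℝ 2 (fderiv ℝ ψ) B := hC.fderiv_of_isOpen hBo (by norm_num)
  have d2 : ∀ v ∈ B, HasFDerivAt (fderiv ℝ ψ) (fderiv ℝ (fderiv ℝ ψ) v) v := fun v hv =>
    ((hC1.contDiffAt (hBo.mem_nhds hv)).differentiableAt (by norm_num)).hasFDerivAt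
  have hC2 : ContDiffOn ℝ 1 (fderiv ℝ (fderiv ℝ ψ)) B := hC1.fderiv_of_isOpen hBo (by norm_num)
  have b2 : ∀ v ∈ B, ‖fderiv ℝ (fderiv ℝ ψ) v‖ ≤ η⁻¹ := by
    intro v hv
    have := hbd v hv
    rw [← norm_iteratedFDeriv_fderiv, ← norm_iteratedFDeriv_fderiv, norm_iteratedFDeriv_zero] at this
    linarith [norm_nonneg (iteratedFDeriv ℝ 3 ψ v)]
  have l2 : ∀ v ∈ B, ∀ w ∈ B, ‖fderiv ℝ (fderiv ℝ ψ) v - fderiv ℝ (fderiv ℝ ψ) w‖ ≤ η⁻¹ * ‖v - w‖ := by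
    refine aux_lip ψ B hBo (convex_ball _ _) η⁻¹ hC2 (fun v hv => ?_)
    linarith [hbd v hv, norm_nonneg (iteratedFDeriv ℝ 2 ψ v)]
  have hPd : ∀ X, HasFDerivAt (fun X => P (X - x)) P X := by
    intro X
    exact P.hasFDerivAt.comp X ((hasFDerivAt_id X).sub_const x)
  let nn : EuclideanSpace ℝ (Fin d) →L[ℝ] ℝ := innerSL ℝ (n x)
  have hnn : ∀ w, nn w = ⟪w, n x⟫ := fun w => by
    simp only [nn, innerSL_apply_apply]; exact real_inner_comm _ _
  let Q : (EuclideanSpace ℝ (Fin (d-1)) →L[ℝ] ℝ) →L[ℝ] (EuclideanSpace ℝ (Fin d) →L[ℝ] ℝ) :=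
    ContinuousLinearMap.precomp ℝ P
  have hQ : ∀ φ w, Q φ w = φ (P w) := fun φ w => rfl
  refine ⟨fun X => nn (X - x) - ψ (P (X - x)), fun X => nn - Q (fderiv ℝ ψ (P (X - x))),
    fun X => - (Q ∘L (fderiv ℝ (fderiv ℝ ψ) (P (X - x)) ∘L P)), ?_, ?_, ?_, ?_, ?_, ?_, ?_, ?_⟩
  · intro X hX
    have h1 : HasFDerivAt (fun X => nn (X - x)) nn X :=
      nn.hasFDerivAt.comp X ((hasFDerivAt_id X).sub_const x)
    exact h1.sub ((d1 _ (hPb X hX)).comp X (hPd X))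
  · intro X hX
    have h1 := Q.hasFDerivAt.comp X ((d2 _ (hPb X hX)).comp X (hPd X))
    have := (hasFDerivAt_const nn X).sub h1
    rw [zero_sub] at this
    exact this
  · intro X hX
    change ‖-(Q ∘L (fderiv ℝ (fderiv ℝ ψ) (P (X - x)) ∘L P))‖ ≤ _
    rw [norm_neg]
    apply ContinuousLinearMap.opNorm_le_bound₂ _ (by positivity)
    intro w w'
    change ‖fderiv ℝ (fderiv ℝ ψ) (P (X - x)) (P w) (P w')‖ ≤ _
    refine (ContinuousLinearMap.le_opNorm₂ _ _ _).trans ?_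
    have := b2 _ (hPb X hX)
    have := hPle w
    have := hPle w'
    gcongr
  · intro X hX Y hY
    apply ContinuousLinearMap.opNorm_le_bound₂ _ (by positivity)
    intro w w'
    have : (-(Q ∘L (fderiv ℝ (fderiv ℝ ψ) (P (X - x)) ∘L P)) - -(Q ∘L (fderiv ℝ (fderiv ℝ ψ) (P (Y - x)) ∘L P))) w w'
      = - ((fderiv ℝ (fderiv ℝ ψ) (P (X - x)) - fderiv ℝ (fderiv ℝ ψ) (P (Y - x))) (P w) (P w')) := by
      simp [hQ]
      ring
    rw [this]
    rw [norm_neg]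
    refine (ContinuousLinearMap.le_opNorm₂ _ _ _).trans ?_
    have h1 := l2 _ (hPb X hX) _ (hPb Y hY)
    rw [← map_sub, sub_sub_sub_cancel_right] at h1
    have := hPle w
    have := hPle w'
    have := hPle (X - Y)
    have h2 : η⁻¹ * ‖P (X - Y)‖ ≤ η⁻¹ * ‖X - Y‖ := by gcongr
    have := h1.trans h2
    gcongr
  · simp [hψ0]
  · intro w
    simp [hdψ0, hnn]
  · intro X hX
    have h1 : X ∈ D ↔ X ∈ D ∩ ball x ε₀ := by simp [hX]
    rw [h1, hset]
    have hs : ∀ u, ψ (projTail d u) < ⟪u, e1 d⟫ ↔ 0 < nn (A₀ u) - ψ (P (A₀ u)) := by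
      intro u
      rw [hPa, ← hAe, Ae.symm_apply_apply, hP0, hnn, ← hA, ← hAe, Ae.inner_map_map, sub_pos]
    constructor
    · rintro ⟨u, ⟨hu1, hu2⟩, rfl⟩
      have := (hs u).1 hu2
      simpa using this
    · intro h
      refine ⟨Ae.symm (X - x), ⟨?_, ?_⟩, ?_⟩
      · rw [mem_ball_zero_iff, Ae.symm.norm_map]
        rwa [mem_ball, dist_eq_norm] at hX
      · rw [hs, ← hAe, Ae.apply_symm_apply]; exact h
      · change x + Ae _ = _
        rw [Ae.apply_symm_apply]; simp
  · intro X hX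
    have hv := hPb X hX
    have key : η * ‖P (X - x)‖ ^ 2 / 2 ≤ ψ (P (X - x)) := by
      set v := P (X - x)
      have hb : ∀ t ∈ Set.Icc (0:ℝ) 1, t • v ∈ B := by
        intro t ht
        rw [mem_ball_zero_iff] at hv ⊢
        rw [norm_smul, Real.norm_of_nonneg ht.1]
        nlinarith [ht.2, norm_nonneg v]
      have hl : ∀ t : ℝ, HasDerivAt (fun t : ℝ => t • v) v t := fun t => by
        simpa using (hasDerivAt_id t).smul_const v
      have := aux_taylor (fun t => ψ (t • v)) (fun t => fderiv ℝ ψ (t • v) v)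
        (fun t => fderiv ℝ (fderiv ℝ ψ) (t • v) v v) (η * ‖v‖ ^ 2)
        (fun t ht => (d1 _ (hb t ht)).comp_hasDerivAt t (hl t))
        (fun t ht => by
          have h := (d2 _ (hb t ht)).comp_hasDerivAt t (hl t)
          exact ((ContinuousLinearMap.apply ℝ ℝ v).hasFDerivAt).comp_hasDerivAt t h)
        (by simp [hψ0]) (by simp [hdψ0])
        (fun t ht => by
          have := hHess _ (hb t ht) v
          rw [iteratedFDeriv_two_apply] at this
          simpa using this)
      simpa using this
    have := hPn (X - x)
    simp only [hnn]
    have e : ‖X - x‖ ^ 2 - ⟪X - x, n x⟫ ^ 2 = ‖P (X - x)‖ ^ 2 := by linarith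
    rw [e]
    linarith

structure ChartP {E : Type*} [NormedAddCommGroup E] [InnerProductSpace ℝ E]
    (D : Set E) (ε₀ η : ℝ) (x nx : E) (f : E → ℝ) (F1 : E → E →L[ℝ] ℝ)
    (F2 : E → E →L[ℝ] E →L[ℝ] ℝ) : Prop where
  d1 : ∀ X ∈ ball x ε₀, HasFDerivAt f (F1 X) X
  d2 : ∀ X ∈ ball x ε₀, HasFDerivAt F1 (F2 X) X
  b2 : ∀ X ∈ ball x ε₀, ‖F2 X‖ ≤ η⁻¹
  l2 : ∀ X ∈ ball x ε₀, ∀ Y ∈ ball x ε₀, ‖F2 X - F2 Y‖ ≤ η⁻¹ * ‖X - Y‖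
  f0 : f x = 0
  g0 : ∀ w, F1 x w = ⟪w, nx⟫
  mem : ∀ X ∈ ball x ε₀, (X ∈ D ↔ 0 < f X)
  sc : ∀ X ∈ ball x ε₀, f X ≤ ⟪X - x, nx⟫ - η / 2 * (‖X - x‖ ^ 2 - ⟪X - x, nx⟫ ^ 2)

lemma aux_cross {E : Type*} [NormedAddCommGroup E] [InnerProductSpace ℝ E]
    (D : Set E) (ho : IsOpen D) (W L : E) (hW : W ∈ closure D) (hL : L ∉ D) :
    ∃ p ∈ frontier D, ‖W - p‖ ≤ ‖W - L‖ := by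
  by_contra! hcon
  have hseg : ∀ p ∈ segment ℝ W L, ‖W - p‖ ≤ ‖W - L‖ := by
    rintro p ⟨a, b, ha, hb, hab, rfl⟩
    have : W - (a • W + b • L) = b • (W - L) := by
      rw [eq_sub_of_add_eq hab]; module
    rw [this, norm_smul, Real.norm_of_nonneg hb]
    nlinarith [norm_nonneg (W - L)]
  have hnf : ∀ p ∈ segment ℝ W L, p ∉ frontier D := fun p hp hf =>
    absurd (hseg p hp) (not_le.2 (hcon p hf))
  have hpre : IsPreconnected (segment ℝ W L) := (convex_segment W L).isPreconnected
  have hnfi : ∀ p ∈ segment ℝ W L, p ∈ closure D → p ∈ D := by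
    intro p hp hc
    by_contra hpD
    exact hnf p hp ⟨hc, by rwa [ho.interior_eq]⟩
  obtain ⟨p, -, hp1, hp2⟩ := hpre D (closure D)ᶜ ho isClosed_closure.isOpen_compl
    (fun p hp => by
      by_cases h : p ∈ closure D
      · exact Or.inl (hnfi p hp h)
      · exact Or.inr h)
    ⟨W, left_mem_segment ℝ W L, hnfi W (left_mem_segment ℝ W L) hW⟩
    ⟨L, right_mem_segment ℝ W L, fun h => hL (hnfi L (right_mem_segment ℝ W L) h)⟩
  exact hp2 (subset_closure hp1)

lemma aux_lam_mem {d : ℕ} (D : Set (EuclideanSpace ℝ (Fin d))) (Y Z : EuclideanSpace ℝ (Fin d))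
    (hY : Y ∈ closure D) :
    lamT D Y Z ∈ {t : ℝ | t ∈ Set.Icc (0 : ℝ) 1 ∧ Y + t • (Z - Y) ∈ closure D} := by
  have hcl : IsClosed {t : ℝ | Y + t • (Z - Y) ∈ closure D} :=
    isClosed_closure.preimage (by fun_prop)
  have hcp : IsCompact {t : ℝ | t ∈ Set.Icc (0 : ℝ) 1 ∧ Y + t • (Z - Y) ∈ closure D} :=
    isCompact_Icc.inter_right hcl
  exact hcp.sSup_mem ⟨0, by simp [hY]⟩

lemma aux_lam {d : ℕ} (D : Set (EuclideanSpace ℝ (Fin d))) (ho : IsOpen D)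
    (Y Z : EuclideanSpace ℝ (Fin d))
    (hY : Y ∈ D) (hZ : Z ∉ D) :
    ∃ t : ℝ, 0 < t ∧ t ≤ 1 ∧ Lam D Y Z = Y + t • (Z - Y) ∧ Y + t • (Z - Y) ∉ D := by
  obtain ⟨⟨h0, h1⟩, -⟩ := aux_lam_mem D Y Z (subset_closure hY)
  have hnot : Y + lamT D Y Z • (Z - Y) ∉ D := by
    intro hmem
    have hlt : lamT D Y Z < 1 := by
      refine lt_of_le_of_ne h1 (fun h => hZ ?_)
      rw [h] at hmem
      simpa using hmem
    have hop : IsOpen {t : ℝ | Y + t • (Z - Y) ∈ D} := ho.preimage (by fun_prop)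
    obtain ⟨ε, he, hb⟩ := Metric.isOpen_iff.1 hop _ hmem
    set s := lamT D Y Z + min (ε / 2) (1 - lamT D Y Z) with hs
    have hm : 0 < min (ε / 2) (1 - lamT D Y Z) := lt_min (by linarith) (by linarith)
    have hsD : Y + s • (Z - Y) ∈ D := by
      apply hb
      rw [mem_ball, Real.dist_eq, hs, add_sub_cancel_left, abs_of_pos hm]
      linarith [min_le_left (ε / 2) (1 - lamT D Y Z)]
    have : s ≤ lamT D Y Z := by
      apply le_csSup
      · exact ⟨1, fun t ht => ht.1.2⟩
      · refine ⟨⟨by linarith, ?_⟩, subset_closure hsD⟩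
        linarith [min_le_right (ε / 2) (1 - lamT D Y Z)]
    linarith
  refine ⟨lamT D Y Z, lt_of_le_of_ne h0 (fun h => hnot ?_), h1, rfl, hnot⟩
  rw [← h]; simpa using hY

section gen
variable {E : Type*} [NormedAddCommGroup E] [InnerProductSpace ℝ E]
    {D : Set E} {ε₀ η : ℝ} {x nx : E} {f : E → ℝ} {F1 : E → E →L[ℝ] ℝ}
    {F2 : E → E →L[ℝ] E →L[ℝ] ℝ}

lemma ChartP.lip1 (h : ChartP D ε₀ η x nx f F1 F2) (hε : 0 < ε₀) (X : E) (hX : X ∈ ball x ε₀) :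
    ‖F1 X - F1 x‖ ≤ η⁻¹ * ‖X - x‖ :=
  Convex.norm_image_sub_le_of_norm_hasFDerivWithin_le
    (fun u hu => (h.d2 u hu).hasFDerivWithinAt) h.b2 (convex_ball _ _) (mem_ball_self hε) hX

lemma line_deriv (x w : E) (t : ℝ) : HasDerivAt (fun t : ℝ => x + t • w) w t := by
  simpa using ((hasDerivAt_id t).smul_const w).const_add x

lemma ChartP.ray1 (h : ChartP D ε₀ η x nx f F1 F2) (p w : E) (t : ℝ)
    (hb : p + t • w ∈ ball x ε₀) :
    HasDerivAt (fun t : ℝ => f (p + t • w)) (F1 (p + t • w) w) t :=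
  (h.d1 _ hb).comp_hasDerivAt t (line_deriv p w t)

lemma ChartP.ray2 (h : ChartP D ε₀ η x nx f F1 F2) (p w : E) (t : ℝ)
    (hb : p + t • w ∈ ball x ε₀) :
    HasDerivAt (fun t : ℝ => F1 (p + t • w) w) (F2 (p + t • w) w w) t := by
  have h1 := (h.d2 _ hb).comp_hasDerivAt t (line_deriv p w t)
  exact ((ContinuousLinearMap.apply ℝ ℝ w).hasFDerivAt).comp_hasDerivAt t h1

lemma ray_mem {x p w : E} {r s ε₀ : ℝ} (hp : ‖p - x‖ ≤ r) (hw : ‖w‖ < s) (hrs : r + s ≤ ε₀)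
    (t : ℝ) (ht : t ∈ Set.Icc (0:ℝ) 1) : p + t • w ∈ ball x ε₀ := by
  rw [mem_ball, dist_eq_norm]
  have : p + t • w - x = (p - x) + t • w := by abel
  rw [this]
  refine (norm_add_le _ _).trans_lt ?_
  rw [norm_smul, Real.norm_of_nonneg ht.1]
  nlinarith [ht.2, norm_nonneg w]

lemma ChartP.low (h : ChartP D ε₀ η x nx f F1 F2) (w : E) (hw : ‖w‖ < ε₀) :
    ⟪w, nx⟫ - η⁻¹ * ‖w‖ ^ 2 / 2 ≤ f (x + w) := by
  have hb : ∀ t ∈ Set.Icc (0:ℝ) 1, x + t • w ∈ ball x ε₀ :=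
    ray_mem (r := 0) (by simp) hw (by simp)
  have := aux_taylor (fun t => f (x + t • w) - t * ⟪w, nx⟫)
    (fun t => F1 (x + t • w) w - ⟪w, nx⟫) (fun t => F2 (x + t • w) w w)
    (-(η⁻¹ * ‖w‖ ^ 2))
    (fun t ht => (h.ray1 x w t (hb t ht)).sub (by
      simpa using (hasDerivAt_id t).mul_const (⟪w, nx⟫ : ℝ)))
    (fun t ht => (h.ray2 x w t (hb t ht)).sub_const _)
    (by simp [h.f0]) (by simp [h.g0])
    (fun t ht => by
      have h1 := (F2 (x + t • w)).le_opNorm₂ w w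
      have h2 := h.b2 _ (hb t ht)
      rw [Real.norm_eq_abs] at h1
      have h3 := (abs_le.1 h1).1
      nlinarith [mul_nonneg (norm_nonneg w) (norm_nonneg w)])
  simp at this
  linarith

lemma ChartP.zero_of_frontier (h : ChartP D ε₀ η x nx f F1 F2) (ho : IsOpen D) (x' : E)
    (hx' : x' ∈ frontier D) (hb : x' ∈ ball x ε₀) : f x' = 0 := by
  have hn : x' ∉ D := by
    have := hx'.2; rwa [ho.interior_eq] at this
  apply le_antisymm
  · by_contra! hc
    exact hn ((h.mem x' hb).2 hc)
  · by_contra! hc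
    have hcont : ContinuousAt f x' := (h.d1 x' hb).continuousAt
    have h1 : ∀ᶠ X in nhds x', f X < 0 := hcont.eventually_lt continuousAt_const hc
    have h2 : ∀ᶠ X in nhds x', X ∈ ball x ε₀ := isOpen_ball.mem_nhds hb
    obtain ⟨X, ⟨hX1, hX2⟩, hXD⟩ := mem_closure_iff_nhds.1 hx'.1 _ (h1.and h2)
    have hX1 : f X < 0 := hX1
    linarith [(h.mem X hX2).1 hXD]

lemma ChartP.normal [CompleteSpace E] (h : ChartP D ε₀ η x nx f F1 F2) (ho : IsOpen D) (x' n' : E)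
    (hx' : x' ∈ frontier D) (hb : x' ∈ ball x ε₀) (hn' : ‖n'‖ = 1)
    (hsup : ∀ X ∈ D, 0 ≤ ⟪X - x', n'⟫) (w : E) : F1 x' w = ‖F1 x'‖ * ⟪w, n'⟫ := by
  have hz := h.zero_of_frontier ho x' hx' hb
  have key : ∀ v, 0 < F1 x' v → 0 ≤ ⟪v, n'⟫ := by
    intro v hv
    have hd := h.ray1 x' v 0 (by simpa using hb)
    have hev : ∀ᶠ t in nhdsWithin (0:ℝ) (Set.Ioi 0), 0 < f (x' + t • v) := by
      have := hd.tendsto_slope_zero_right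
      simp only [zero_add, zero_smul, add_zero, hz, sub_zero] at this
      have h1 := this.eventually (lt_mem_nhds hv)
      filter_upwards [h1, self_mem_nhdsWithin] with t ht ht0
      rw [smul_eq_mul] at ht
      exact (pos_iff_pos_of_mul_pos ht).1 (inv_pos.2 ht0)
    have hev2 : ∀ᶠ t in nhdsWithin (0:ℝ) (Set.Ioi 0), x' + t • v ∈ ball x ε₀ := by
      apply Filter.Eventually.filter_mono nhdsWithin_le_nhds
      have : ContinuousAt (fun t : ℝ => x' + t • v) 0 := by fun_prop
      refine this.eventually (p := fun y => y ∈ ball x ε₀) ?_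
      simp only [zero_smul, add_zero]
      exact isOpen_ball.mem_nhds hb
    obtain ⟨t, ht1, ht2, ht0⟩ := (hev.and (hev2.and self_mem_nhdsWithin)).exists
    have := hsup _ ((h.mem _ ht2).2 ht1)
    rw [add_sub_cancel_left, real_inner_smul_left] at this
    exact nonneg_of_mul_nonneg_right this ht0
  set g := (InnerProductSpace.toDual ℝ E).symm (F1 x') with hg
  have hgv : ∀ v, F1 x' v = ⟪g, v⟫ := fun v => by simp [hg]
  have hgn : ‖F1 x'‖ = ‖g‖ := by simp [hg]
  rw [hgv, hgn]
  by_cases hg0 : g = 0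
  · simp [hg0]
  have hgp : 0 < ‖g‖ := norm_pos_iff.2 hg0
  have heq : ⟪g, n'⟫ = ‖g‖ * ‖n'‖ := by
    apply le_antisymm (real_inner_le_norm _ _)
    by_contra! hlt
    rw [hn', mul_one] at hlt
    have h1 := key (g - ‖g‖ • n') (by
      rw [hgv, inner_sub_right, inner_smul_right, real_inner_self_eq_norm_sq]
      nlinarith)
    rw [inner_sub_left, real_inner_smul_left, real_inner_self_eq_norm_sq, hn'] at h1
    linarith
  have := inner_eq_norm_mul_iff_real.1 heq
  rw [hn', one_smul] at this
  rw [this, real_inner_smul_left, real_inner_comm]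
  simp [norm_smul, hn']

set_option maxHeartbeats 1000000 in
lemma ChartP.comp [CompleteSpace E] (h : ChartP D ε₀ η x nx f F1 F2) (ho : IsOpen D) (hε : 0 < ε₀)
    (hη : 0 < η) (x' n' : E) (hnx : ‖nx‖ = 1)
    (hx' : x' ∈ frontier D) (hn' : ‖n'‖ = 1)
    (hsup : ∀ X ∈ D, 0 ≤ ⟪X - x', n'⟫)
    (r : ℝ) (hr1 : 2 * r ≤ ε₀) (hr1' : r ≤ 1) (hr2 : η⁻¹ * r ≤ 1 / 2) (hxx : ‖x - x'‖ < r)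
    (a a' : E) (s q : ℝ) (hs : s < r) (ha : ‖a‖ = s) (ha' : ‖a'‖ = s) (hq : ‖a - a'‖ ≤ q * s)
    (haa : (⟪a, nx⟫ : ℝ) = ⟪a', n'⟫) (hmem : x' + a' ∈ D) :
    - ((3 * η⁻¹ + 2 * η⁻¹ ^ 2) * (‖x - x'‖ + q) * s ^ 2) ≤ f (x + a) := by
  have hr0 : 0 < r := (norm_nonneg _).trans_lt hxx
  have hs0 : 0 ≤ s := ha ▸ norm_nonneg _
  have hM : 0 < η⁻¹ := inv_pos.2 hη
  set M := η⁻¹ with hMd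
  have hxx' : ‖x' - x‖ < r := by rwa [norm_sub_rev]
  have hb' : x' ∈ ball x ε₀ := by rw [mem_ball, dist_eq_norm]; linarith
  have hnor := h.normal ho x' n' hx' hb' hn' hsup
  have hz := h.zero_of_frontier ho x' hx' hb'
  set N := ‖F1 x'‖ with hN
  have hF1 : ‖F1 x‖ = 1 := by
    have : F1 x = innerSL ℝ nx := by
      ext w; rw [h.g0, innerSL_apply_apply, real_inner_comm]
    rw [this, innerSL_apply_norm, hnx]
  have hl := h.lip1 hε x' hb'
  have hN1 : |N - 1| ≤ M * ‖x - x'‖ := by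
    rw [norm_sub_rev x, ← hF1, hN]
    exact (abs_norm_sub_norm_le _ _).trans hl
  have hN2 : 1 / 2 ≤ N := by
    have := (abs_le.1 hN1).1
    nlinarith
  have hN0 : 0 < N := by linarith
  have hNi : |1 - N⁻¹| ≤ 2 * M * ‖x - x'‖ := by
    have : 1 - N⁻¹ = (N - 1) * N⁻¹ := by field_simp
    rw [this, abs_mul, abs_of_pos (inv_pos.2 hN0)]
    have h2 : N⁻¹ ≤ 2 := by
      rw [inv_le_comm₀ hN0 (by norm_num)]; linarith
    calc |N - 1| * N⁻¹ ≤ (M * ‖x - x'‖) * 2 := by gcongr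
      _ = _ := by ring
  have hbx : ∀ t ∈ Set.Icc (0:ℝ) 1, x + t • a ∈ ball x ε₀ :=
    ray_mem (r := 0) (s := r) (by simp) (by rw [ha]; exact hs) (by linarith)
  have hbx' : ∀ t ∈ Set.Icc (0:ℝ) 1, x' + t • a' ∈ ball x ε₀ :=
    ray_mem (r := r) (s := r) hxx'.le (by rw [ha']; exact hs) (by linarith)
  have hq0 : 0 ≤ q * s := (norm_nonneg _).trans hq
  have main := aux_taylor (fun t => f (x + t • a) - N⁻¹ * f (x' + t • a'))
    (fun t => F1 (x + t • a) a - N⁻¹ * F1 (x' + t • a') a')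
    (fun t => F2 (x + t • a) a a - N⁻¹ * F2 (x' + t • a') a' a')
    (-((3 * M + 2 * M ^ 2) * (‖x - x'‖ + q) * s ^ 2))
    (fun t ht => (h.ray1 x a t (hbx t ht)).sub ((h.ray1 x' a' t (hbx' t ht)).const_mul _))
    (fun t ht => (h.ray2 x a t (hbx t ht)).sub ((h.ray2 x' a' t (hbx' t ht)).const_mul _))
    (by simp [h.f0, hz]) (by
      simp only [zero_smul, add_zero, h.g0, hnor]
      rw [haa]; field_simp; simp)
    (fun t ht => by
      set p := x + t • a
      set p' := x' + t • a'
      have e : F2 p a a - N⁻¹ * F2 p' a' a' = (F2 p - F2 p') a a + F2 p' (a - a') a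
          + F2 p' a' (a - a') + (1 - N⁻¹) * F2 p' a' a' := by
        simp only [map_sub, sub_apply]; ring
      have hpp : ‖p - p'‖ ≤ ‖x - x'‖ + q * s := by
        have : p - p' = (x - x') + t • (a - a') := by simp only [p, p']; module
        rw [this]
        refine (norm_add_le _ _).trans ?_
        rw [norm_smul, Real.norm_of_nonneg ht.1]
        nlinarith [ht.2, norm_nonneg (a - a'), ht.1]
      have B0 := h.b2 _ (hbx' t ht)
      have B1 : |(F2 p - F2 p') a a| ≤ M * (‖x - x'‖ + q * s) * s * s := by
        have h1 := (F2 p - F2 p').le_opNorm₂ a a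
        rw [ha, Real.norm_eq_abs] at h1
        refine h1.trans ?_
        have h2 := (h.l2 _ (hbx t ht) _ (hbx' t ht)).trans (mul_le_mul_of_nonneg_left hpp hM.le)
        gcongr
      have B2 : |F2 p' (a - a') a| ≤ M * (q * s) * s := by
        have h1 := (F2 p').le_opNorm₂ (a - a') a
        rw [ha, Real.norm_eq_abs] at h1
        refine h1.trans ?_
        gcongr
      have B3 : |F2 p' a' (a - a')| ≤ M * s * (q * s) := by
        have h1 := (F2 p').le_opNorm₂ a' (a - a')
        rw [ha', Real.norm_eq_abs] at h1
        refine h1.trans ?_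
        gcongr
      have B4 : |(1 - N⁻¹) * F2 p' a' a'| ≤ 2 * M * ‖x - x'‖ * (M * s * s) := by
        have h1 := (F2 p').le_opNorm₂ a' a'
        rw [ha', Real.norm_eq_abs] at h1
        rw [abs_mul]
        have h2 : |F2 p' a' a'| ≤ M * s * s := h1.trans (by gcongr)
        gcongr
      rw [e]
      have c1 := (abs_le.1 B1).1
      have c2 := (abs_le.1 B2).1
      have c3 := (abs_le.1 B3).1
      have c4 := (abs_le.1 B4).1
      have hxn := norm_nonneg (x - x')
      have hs1 : s ≤ 1 := by linarith
      have i1 : M * (q * s) * s * s ≤ M * (q * s) * s := by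
        have : 0 ≤ M * (q * s) * s := by positivity
        nlinarith
      have i2 : 0 ≤ M * ‖x - x'‖ * s ^ 2 := by positivity
      have i3 : 0 ≤ M ^ 2 * (q * s) * s := by positivity
      linarith)
  have hpos := (h.mem (x' + a') (by simpa using hbx' 1 (by simp))).1 hmem
  have hNf : 0 < N⁻¹ * f (x' + a') := by positivity
  simp only [one_smul] at main
  have i4 : 0 ≤ (3 * M + 2 * M ^ 2) * (‖x - x'‖ * s ^ 2 + (q * s) * s) := by positivity
  linarith

lemma ChartP.push (h : ChartP D ε₀ η x nx f F1 F2)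
    (hη : 0 < η) (hnx : ‖nx‖ = 1)
    (r : ℝ) (hr1 : r ≤ ε₀) (hr0 : 0 < r) (hr2 : η⁻¹ * r ≤ 1 / 2)
    (Z : E) (s : ℝ) (hs : 0 ≤ s) (hZ : Z ∈ ball x r) (hZ2 : Z + s • nx ∈ ball x r)
    (hpos : 0 < f Z + s / 2) : Z + s • nx ∈ D := by
  have hsub : ball x r ⊆ ball x ε₀ := ball_subset_ball hr1
  rw [h.mem _ (hsub hZ2)]
  have hd : ∀ X ∈ ball x r, HasFDerivWithinAt (fun X => f X - F1 x X) (F1 X - F1 x) (ball x r) X :=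
    fun X hX => ((h.d1 X (hsub hX)).sub (F1 x).hasFDerivAt).hasFDerivWithinAt
  have hb : ∀ X ∈ ball x r, ‖F1 X - F1 x‖ ≤ 1 / 2 := by
    intro X hX
    refine (h.lip1 (by linarith) X (hsub hX)).trans ?_
    have : ‖X - x‖ ≤ r := by rw [mem_ball, dist_eq_norm] at hX; exact hX.le
    have hM : 0 < η⁻¹ := inv_pos.2 hη
    nlinarith
  have := Convex.norm_image_sub_le_of_norm_hasFDerivWithin_le hd hb (convex_ball _ _) hZ hZ2
  rw [add_sub_cancel_left, norm_smul, hnx, Real.norm_of_nonneg hs, Real.norm_eq_abs] at this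
  have h1 := (abs_le.1 this).1
  simp only [map_add, map_smul, h.g0 nx, real_inner_self_eq_norm_sq, hnx, smul_eq_mul] at h1
  linarith

end gen

lemma aux_chartP {d : ℕ} {D : Set (EuclideanSpace ℝ (Fin d))} {ε₀ η : ℝ}
    {n : EuclideanSpace ℝ (Fin d) → EuclideanSpace ℝ (Fin d)}
    (hD : AssumptionD d D ε₀ η n) (x : EuclideanSpace ℝ (Fin d)) (hx : x ∈ frontier D) :
    ∃ f F1 F2, ChartP D ε₀ η x (n x) f F1 F2 := by
  obtain ⟨f, F1, F2, h1, h2, h3, h4, h5, h6, h7, h8⟩ := aux_chart hD x hx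
  exact ⟨f, F1, F2, h1, h2, h3, h4, h5, h6, h7, h8⟩

lemma aux_bound {d : ℕ} {D : Set (EuclideanSpace ℝ (Fin d))} (hb : Bornology.IsBounded D) :
    ∃ R : ℝ, 1 ≤ R ∧ ∀ X ∈ closure D, ∀ Y ∈ closure D, ‖X - Y‖ ≤ R := by
  obtain ⟨R, hR⟩ := Metric.isBounded_iff.1 hb.closure
  refine ⟨max R 1, le_max_right _ _, fun X hX Y hY => ?_⟩
  rw [← dist_eq_norm]
  exact (hR hX hY).trans (le_max_left _ _)

lemma aux_support {d : ℕ} {D : Set (EuclideanSpace ℝ (Fin d))} {ε₀ η : ℝ}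
    {n : EuclideanSpace ℝ (Fin d) → EuclideanSpace ℝ (Fin d)}
    (hD : AssumptionD d D ε₀ η n) :
    ∃ c : ℝ, 0 < c ∧ ∀ x ∈ frontier D, ∀ X ∈ closure D, c * ‖X - x‖ ^ 2 ≤ ⟪X - x, n x⟫ := by
  have hη := hD.eta_pos
  have hε := hD.eps_pos
  have hε1 := hD.eps_lt_one
  obtain ⟨R, hR1, hR⟩ := aux_bound hD.isBounded
  set c0 := (η / 2) / (1 + η / 2) with hc0
  have hc0p : 0 < c0 := by positivity
  set τ := ε₀ / (2 * R) with hτ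
  have hτp : 0 < τ := by positivity
  have hτ1 : τ < 1 := by
    rw [hτ, div_lt_one (by positivity)]; linarith
  have hτR : τ * R = ε₀ / 2 := by rw [hτ]; field_simp
  refine ⟨c0 * τ, by positivity, fun x hx => ?_⟩
  obtain ⟨f, F1, F2, hch⟩ := aux_chartP hD x hx
  have loc : ∀ X ∈ D, ‖X - x‖ < ε₀ → c0 * ‖X - x‖ ^ 2 ≤ ⟪X - x, n x⟫ := by
    intro X hX hlt
    have hb : X ∈ ball x ε₀ := by rwa [mem_ball, dist_eq_norm]
    have h1 := (hch.mem X hb).1 hX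
    have h2 := hch.sc X hb
    have h3 := real_inner_le_norm (X - x) (n x)
    have h3' := neg_le_of_abs_le (abs_real_inner_le_norm (X - x) (n x))
    rw [hD.normal_norm x hx, mul_one] at h3 h3'
    generalize (⟪X - x, n x⟫ : ℝ) = a at *
    set r := ‖X - x‖
    have h4 : a ^ 2 ≤ r ^ 2 := sq_le_sq' h3' h3
    have h5 : 0 < a := by nlinarith
    have h6 : a ^ 2 ≤ a := by nlinarith
    rw [hc0, div_mul_eq_mul_div, div_le_iff₀ (by positivity)]
    nlinarith
  have glob : D ⊆ {X | c0 * τ * ‖X - x‖ ^ 2 ≤ ⟪X - x, n x⟫} := by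
    intro X hX
    have hm : x + τ • (X - x) ∈ D := by
      have := hD.convex.openSegment_closure_interior_subset_interior hx.1
        (by rwa [hD.isOpen.interior_eq] : X ∈ interior D)
      rw [hD.isOpen.interior_eq] at this
      apply this
      exact ⟨1 - τ, τ, by linarith, hτp, by ring, by module⟩
    have hr := hR X (subset_closure hX) x hx.1
    have e : x + τ • (X - x) - x = τ • (X - x) := by abel
    have hnorm : ‖τ • (X - x)‖ = τ * ‖X - x‖ := by
      rw [norm_smul, Real.norm_of_nonneg hτp.le]
    have := loc _ hm (by
      rw [e, hnorm]; nlinarith)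
    rw [e, hnorm, real_inner_smul_left] at this
    change c0 * τ * ‖X - x‖ ^ 2 ≤ ⟪X - x, n x⟫
    have : τ * (c0 * τ * ‖X - x‖ ^ 2) ≤ τ * ⟪X - x, n x⟫ := by linarith
    exact le_of_mul_le_mul_left this hτp
  have hcl : IsClosed {X | c0 * τ * ‖X - x‖ ^ 2 ≤ ⟪X - x, n x⟫} :=
    isClosed_le (by fun_prop) (by fun_prop)
  exact fun X hX => closure_minimal glob hcl hX

set_option maxHeartbeats 2000000 in
lemma aux_compare {d : ℕ} {D : Set (EuclideanSpace ℝ (Fin d))} {ε₀ η : ℝ}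
    {n : EuclideanSpace ℝ (Fin d) → EuclideanSpace ℝ (Fin d)}
    (hD : AssumptionD d D ε₀ η n) :
    ∃ C : ℝ, 0 < C ∧ ∀ x ∈ frontier D, ∀ x' ∈ frontier D,
      ∀ A : EuclideanSpace ℝ (Fin d) →ₗᵢ[ℝ] EuclideanSpace ℝ (Fin d), A (e1 d) = n x →
      ∀ A' : EuclideanSpace ℝ (Fin d) →ₗᵢ[ℝ] EuclideanSpace ℝ (Fin d), A' (e1 d) = n x' →
      ∀ z, x' + A' z ∈ D → ∃ Z ∈ closure D, ‖x + A z - Z‖ ≤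
        C * (‖x - x'‖ + ‖A.toContinuousLinearMap - A'.toContinuousLinearMap‖) * ‖z‖ ^ 2 := by
  have hη := hD.eta_pos
  have hε := hD.eps_pos
  have hε1 := hD.eps_lt_one
  obtain ⟨R, hR1, hR⟩ := aux_bound hD.isBounded
  obtain ⟨c, hc, hsup⟩ := aux_support hD
  have hM : 0 < η⁻¹ := inv_pos.2 hη
  set M := η⁻¹ with hMd
  set r := min (ε₀ / 2) (η / 2) with hr
  have hr0 : 0 < r := lt_min (by linarith) (by linarith)
  have hr1 : 2 * r ≤ ε₀ := by linarith [min_le_left (ε₀ / 2) (η / 2)]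
  have hr2 : M * r ≤ 1 / 2 := by
    calc M * r ≤ M * (η / 2) := by gcongr; exact min_le_right _ _
      _ = 1 / 2 := by rw [hMd]; field_simp
  set C1 := M / r + (3 * M + 2 * M ^ 2) with hC1
  have hC1p : 0 < C1 := by positivity
  set K := 2 * C1 + 2 with hK
  have hKp : 0 < K := by positivity
  set r0 := min (r / 2) (r / (2 * K * (R + 2))) with hr0d
  have hr0p : 0 < r0 := lt_min (by linarith) (by positivity)
  have hr0a : r0 ≤ r / 2 := min_le_left _ _
  have hr0b : K * (R + 2) * r0 ≤ r / 2 := by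
    calc K * (R + 2) * r0 ≤ K * (R + 2) * (r / (2 * K * (R + 2))) := by
          gcongr; exact min_le_right _ _
      _ = r / 2 := by field_simp
  refine ⟨K + (1 + R) / r0 ^ 2, by positivity, fun x hx x' hx' A hA A' hA' z hz => ?_⟩
  set q := ‖A.toContinuousLinearMap - A'.toContinuousLinearMap‖ with hq
  have hq0 : 0 ≤ q := norm_nonneg _
  have hq2 : q ≤ 2 := by
    have h1 := norm_sub_le A.toContinuousLinearMap A'.toContinuousLinearMap
    linarith [A.norm_toContinuousLinearMap_le, A'.norm_toContinuousLinearMap_le]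
  have hAq : ∀ w, ‖A w - A' w‖ ≤ q * ‖w‖ := fun w =>
    (A.toContinuousLinearMap - A'.toContinuousLinearMap).le_opNorm w
  have hzR : ‖z‖ ≤ R := by
    have := hR _ (subset_closure hz) x' hx'.1
    rwa [add_sub_cancel_left, A'.norm_map] at this
  have hxR : ‖x - x'‖ ≤ R := hR x hx.1 x' hx'.1
  have hxn := norm_nonneg (x - x')
  have hzn := norm_nonneg z
  have hdiff : ‖x + A z - (x' + A' z)‖ ≤ (‖x - x'‖ + q) * (1 + R) := by
    have : x + A z - (x' + A' z) = (x - x') + (A z - A' z) := by abel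
    rw [this]
    refine (norm_add_le _ _).trans ?_
    nlinarith [hAq z]
  set ρ := ‖x - x'‖ + q with hρ
  have hρ0 : 0 ≤ ρ := by positivity
  by_cases hbig : r0 ≤ ‖z‖ ∨ ρ = 0
  · refine ⟨x' + A' z, subset_closure hz, hdiff.trans ?_⟩
    rcases hbig with h | h
    · have h1 : r0 ^ 2 ≤ ‖z‖ ^ 2 := by gcongr
      have h2 : (1 + R) = (1 + R) / r0 ^ 2 * r0 ^ 2 := by field_simp
      calc ρ * (1 + R) = (1 + R) / r0 ^ 2 * ρ * r0 ^ 2 := by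
            field_simp
        _ ≤ (K + (1 + R) / r0 ^ 2) * ρ * ‖z‖ ^ 2 := by
            gcongr
            linarith
    · rw [h]; simp
  push Not at hbig
  obtain ⟨hzs, hρne⟩ := hbig
  have hρp : 0 < ρ := lt_of_le_of_ne hρ0 (Ne.symm hρne)
  by_cases hz0 : z = 0
  · exact ⟨x, hx.1, by simp [hz0]⟩
  have hzp : 0 < ‖z‖ := norm_pos_iff.2 hz0
  obtain ⟨f, F1, F2, hch⟩ := aux_chartP hD x hx
  have hinx : (⟪A z, n x⟫ : ℝ) = ⟪z, e1 d⟫ := by rw [← hA, A.inner_map_map]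
  have hinx' : (⟪A' z, n x'⟫ : ℝ) = ⟪z, e1 d⟫ := by rw [← hA', A'.inner_map_map]
  have hsup' : ∀ X ∈ D, 0 ≤ (⟪X - x', n x'⟫ : ℝ) := fun X hX =>
    le_trans (by positivity) (hsup x' hx' X (subset_closure hX))
  have hlow : -(C1 * ρ * ‖z‖ ^ 2) ≤ f (x + A z) := by
    by_cases hxx : ‖x - x'‖ < r
    · have := hch.comp hD.isOpen hε hη x' (n x') (hD.normal_norm x hx) hx' (hD.normal_norm x' hx')
        hsup' r hr1 (by linarith) hr2 hxx (A z) (A' z) ‖z‖ q (by linarith) (A.norm_map z)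
        (A'.norm_map z) (hAq z) (hinx.trans hinx'.symm) hz
      refine le_trans ?_ this
      rw [neg_le_neg_iff]
      have : 0 ≤ M / r := by positivity
      gcongr
      linarith
    · push Not at hxx
      have h1 := hch.low (A z) (by rw [A.norm_map]; linarith)
      rw [A.norm_map, hinx, ← hinx'] at h1
      have h2 := hsup' _ hz
      rw [add_sub_cancel_left] at h2
      have h3 : M * ‖z‖ ^ 2 ≤ C1 * ρ * ‖z‖ ^ 2 := by
        gcongr
        calc M = M / r * r := by field_simp
          _ ≤ C1 * ρ := by
            have : 0 ≤ 3 * M + 2 * M ^ 2 := by positivity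
            gcongr
            · linarith
            · linarith
      have h4 : 0 ≤ M * ‖z‖ ^ 2 := by positivity
      linarith
  set s := K * ρ * ‖z‖ ^ 2 with hs
  have hsp : 0 < s := by positivity
  have hsle : s ≤ r / 2 := by
    have h1 : ‖z‖ ^ 2 ≤ r0 := by nlinarith
    calc s ≤ K * (R + 2) * r0 := by
          rw [hs]; gcongr; linarith
      _ ≤ _ := hr0b
  have hZb : x + A z ∈ ball x r := by
    rw [mem_ball, dist_eq_norm, add_sub_cancel_left, A.norm_map]; linarith
  have hnx := hD.normal_norm x hx
  have hZb2 : x + A z + s • n x ∈ ball x r := by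
    rw [mem_ball, dist_eq_norm, add_assoc, add_sub_cancel_left]
    refine (norm_add_le _ _).trans_lt ?_
    rw [A.norm_map, norm_smul, hnx, Real.norm_of_nonneg hsp.le]
    linarith
  have hin := hch.push hη hnx r (by linarith) hr0 hr2 (x + A z) s hsp.le hZb hZb2 (by
    have : 0 < ρ * ‖z‖ ^ 2 := by positivity
    rw [hs, hK]
    nlinarith)
  refine ⟨_, subset_closure hin, ?_⟩
  rw [sub_add_cancel_left, norm_neg, norm_smul, hnx, Real.norm_of_nonneg hsp.le, mul_one, hs]
  have : 0 ≤ (1 + R) / r0 ^ 2 := by positivity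
  gcongr
  linarith

set_option maxHeartbeats 4000000 in
lemma aux_two {d : ℕ} {D : Set (EuclideanSpace ℝ (Fin d))} {ε₀ η : ℝ}
    {n : EuclideanSpace ℝ (Fin d) → EuclideanSpace ℝ (Fin d)}
    (hD : AssumptionD d D ε₀ η n) :
    ∃ C : ℝ, 0 < C ∧
      ∀ x ∈ frontier D, ∀ x' ∈ frontier D,
      ∀ A : EuclideanSpace ℝ (Fin d) →ₗᵢ[ℝ] EuclideanSpace ℝ (Fin d), A (e1 d) = n x →
      ∀ A' : EuclideanSpace ℝ (Fin d) →ₗᵢ[ℝ] EuclideanSpace ℝ (Fin d), A' (e1 d) = n x' →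
        (∀ y z : EuclideanSpace ℝ (Fin d),
          x + A y ∈ D → x' + A' y ∈ D → x + A z ∉ D → x' + A' z ∈ D →
          |‖Lam D (x + A y) (x + A z) - (x' + A' z)‖ - ‖x - x'‖| ≤
            C * (‖x - x'‖ + ‖A.toContinuousLinearMap - A'.toContinuousLinearMap‖) *
              (min ‖z‖ 1 + ‖y‖ * min ‖y - z‖ 1 /
                Metric.infDist (x + A y) (frontier D))) := by
  obtain ⟨R, hR1, hR⟩ := aux_bound hD.isBounded
  obtain ⟨c, hc, hsup⟩ := aux_support hD
  obtain ⟨C, hC, hcomp⟩ := aux_compare hD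
  set C3 := 16 * C / c + 4 * C * R with hC3
  have hC3p : 0 < C3 := by positivity
  refine ⟨R + C3 * 2 * R + C * 4 * R ^ 2, by positivity,
    fun x hx x' hx' A hA A' hA' y z hY hY' hZ hZ' => ?_⟩
  obtain ⟨Z2, hZ2, hZ2d⟩ := hcomp x hx x' hx' A hA A' hA' z hZ'
  set q := ‖A.toContinuousLinearMap - A'.toContinuousLinearMap‖ with hq
  have hq0 : 0 ≤ q := norm_nonneg _
  have hAq : ‖A z - A' z‖ ≤ q * ‖z‖ :=
    (A.toContinuousLinearMap - A'.toContinuousLinearMap).le_opNorm z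
  have hxn := norm_nonneg (x - x')
  have hzn := norm_nonneg z
  have hyn := norm_nonneg y
  set ρ := ‖x - x'‖ + q with hρ
  have hρ0 : 0 ≤ ρ := by positivity
  have hzR : ‖z‖ ≤ R := by
    have := hR _ (subset_closure hZ') x' hx'.1
    rwa [add_sub_cancel_left, A'.norm_map] at this
  have hyzR : ‖y - z‖ ≤ R := by
    have := hR _ (subset_closure hY') _ (subset_closure hZ')
    rwa [add_sub_add_left_eq_sub, ← map_sub, A'.norm_map] at this
  have hYZ : ‖(x + A y) - (x + A z)‖ = ‖y - z‖ := by
    rw [add_sub_add_left_eq_sub, ← map_sub, A.norm_map]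
  have hmin : ∀ a : ℝ, 0 ≤ a → a ≤ R → a ≤ R * min a 1 := by
    intro a ha haR
    rcases min_cases a 1 with ⟨h, _⟩ | ⟨h, _⟩ <;> rw [h] <;> nlinarith
  set Y := x + A y with hYd
  set Z := x + A z with hZd
  obtain ⟨t, ht0, ht1, hLam, hLn⟩ := aux_lam D hD.isOpen Y Z hY hZ
  rw [hLam]
  set L := Y + t • (Z - Y) with hL
  set δ := infDist Y (frontier D) with hδ
  have hδ0 : 0 < δ := by
    rw [hδ, ← isClosed_frontier.notMem_iff_infDist_pos ⟨x, hx⟩]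
    intro h
    have := h.2
    rw [hD.isOpen.interior_eq] at this
    exact this hY
  set W := Y + t • (Z2 - Y) with hW
  have hWc : W ∈ closure D := by
    have := hD.convex.closure (subset_closure hY) hZ2 (by linarith : 0 ≤ 1 - t) ht0.le (by ring)
    convert this using 1
    rw [hW]; module
  obtain ⟨p, hp, hpW⟩ := aux_cross D hD.isOpen W L hWc hLn
  have hWL : ‖W - L‖ ≤ t * (C * ρ * ‖z‖ ^ 2) := by
    have : W - L = -(t • (Z - Z2)) := by rw [hW, hL]; module
    rw [this, norm_neg, norm_smul, Real.norm_of_nonneg ht0.le]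
    gcongr
  have hnp := hD.normal_norm p hp
  have hup : (⟪W - p, n p⟫ : ℝ) ≤ t * (C * ρ * ‖z‖ ^ 2) := by
    have := real_inner_le_norm (W - p) (n p)
    rw [hnp, mul_one] at this
    linarith
  have hsplit : (⟪W - p, n p⟫ : ℝ) = (1 - t) * ⟪Y - p, n p⟫ + t * ⟪Z2 - p, n p⟫ := by
    rw [← real_inner_smul_left, ← real_inner_smul_left, ← inner_add_left]
    congr 1
    rw [hW]; module
  have hsY := hsup p hp Y (subset_closure hY)
  have hsZ := hsup p hp Z2 hZ2
  have hquad : t * (1 - t) * ‖Y - Z2‖ ^ 2 ≤ (1 - t) * ‖Y - p‖ ^ 2 + t * ‖Z2 - p‖ ^ 2 := by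
    have e1 : Y - Z2 = (Y - p) - (Z2 - p) := by abel
    have h1 := norm_sub_sq_real (Y - p) (Z2 - p)
    rw [← e1] at h1
    have h2 := norm_add_sq_real ((1 - t) • (Y - p)) (t • (Z2 - p))
    rw [norm_smul, norm_smul, real_inner_smul_left, real_inner_smul_right,
      Real.norm_of_nonneg ht0.le, Real.norm_of_nonneg (by linarith : 0 ≤ 1 - t)] at h2
    have h3 := sq_nonneg ‖(1 - t) • (Y - p) + t • (Z2 - p)‖
    rw [h2] at h3
    rw [h1]
    nlinarith
  have hF : c * (1 - t) * ‖Y - Z2‖ ^ 2 ≤ C * ρ * ‖z‖ ^ 2 := by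
    have h1 : t * (c * (1 - t) * ‖Y - Z2‖ ^ 2) ≤ t * (C * ρ * ‖z‖ ^ 2) := by
      have a1 := mul_le_mul_of_nonneg_left hquad hc.le
      have a2 := mul_le_mul_of_nonneg_left hsY (by linarith : 0 ≤ 1 - t)
      have a3 := mul_le_mul_of_nonneg_left hsZ ht0.le
      linarith
    exact le_of_mul_le_mul_left h1 ht0
  have hYδ : δ ≤ ⟪Y - p, n p⟫ := by
    apply le_of_forall_lt
    intro s hs
    by_cases hs0 : s < 0
    · exact lt_of_lt_of_le hs0 (le_trans (by positivity) hsY)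
    push Not at hs0
    obtain ⟨s', hs', hs'δ⟩ := exists_between hs
    have hin : Y - s' • n p ∈ D := by
      by_contra hno
      obtain ⟨p', hp', hpp⟩ := aux_cross D hD.isOpen Y _ (subset_closure hY) hno
      rw [sub_sub_cancel, norm_smul, hnp, Real.norm_of_nonneg (by linarith), mul_one] at hpp
      have := infDist_le_dist_of_mem (x := Y) hp'
      rw [dist_eq_norm] at this
      linarith
    have h1 := le_trans (by positivity) (hsup p hp _ (subset_closure hin))
    have e : Y - s' • n p - p = (Y - p) - s' • n p := by abel
    rw [e, inner_sub_left, real_inner_smul_left, real_inner_self_eq_norm_sq, hnp] at h1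
    linarith
  have hG : (1 - t) * δ ≤ C * ρ * ‖z‖ ^ 2 := by
    have a2 := mul_le_mul_of_nonneg_left hYδ (by linarith : 0 ≤ 1 - t)
    have a3 : 0 ≤ t * ⟪Z2 - p, n p⟫ := mul_nonneg ht0.le (le_trans (by positivity) hsZ)
    have a4 : 0 ≤ C * ρ * ‖z‖ ^ 2 := by positivity
    nlinarith
  have hLZ : ‖L - Z‖ = (1 - t) * ‖y - z‖ := by
    have : L - Z = (1 - t) • (Y - Z) := by rw [hL]; module
    rw [this, norm_smul, Real.norm_of_nonneg (by linarith), hYZ]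
  have hyz0 := norm_nonneg (y - z)
  have key : (1 - t) * ‖y - z‖ ≤ C3 * 2 * R * ρ * min ‖z‖ 1
      + C * 4 * R ^ 2 * ρ * (‖y‖ * min ‖y - z‖ 1 / δ) := by
    have hm1 : 0 ≤ min ‖z‖ 1 := le_min hzn zero_le_one
    have hm2 : 0 ≤ min ‖y - z‖ 1 := le_min hyz0 zero_le_one
    by_cases hcase : 2 * ‖y‖ ≤ ‖z‖
    · have hyz1 : ‖z‖ / 2 ≤ ‖y - z‖ := by
        have := norm_sub_norm_le z y
        rw [norm_sub_rev z y] at this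
        linarith
      have hyz2 : ‖y - z‖ ≤ 2 * ‖z‖ := by
        have := norm_sub_le y z
        linarith
      have ht : (1 - t) * ‖y - z‖ ≤ C3 * ρ * (2 * ‖z‖) := by
        by_cases hz0 : ‖z‖ = 0
        · have : ‖y - z‖ = 0 := by linarith
          rw [this, hz0]; simp
        have hzp : 0 < ‖z‖ := lt_of_le_of_ne hzn (Ne.symm hz0)
        have : 1 - t ≤ C3 * ρ := by
          by_cases hsm : C * ρ * ‖z‖ ^ 2 ≤ ‖z‖ / 4
          · have h1 : ‖z‖ / 4 ≤ ‖Y - Z2‖ := by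
              have h2 := norm_sub_le_norm_sub_add_norm_sub Y Z2 Z
              rw [hYZ, norm_sub_rev Z2 Z] at h2
              linarith
            have h2 : (‖z‖ / 4) ^ 2 ≤ ‖Y - Z2‖ ^ 2 := by gcongr
            have h3 : c * (1 - t) * (‖z‖ / 4) ^ 2 ≤ C * ρ * ‖z‖ ^ 2 :=
              le_trans (mul_le_mul_of_nonneg_left h2
                (mul_nonneg hc.le (by linarith))) hF
            have h4 : (c * (1 - t)) * ‖z‖ ^ 2 ≤ (16 * C * ρ) * ‖z‖ ^ 2 := by nlinarith
            have h5 := le_of_mul_le_mul_right h4 (by positivity)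
            have h6 : 1 - t ≤ 16 * C / c * ρ := by
              rw [div_mul_eq_mul_div, le_div_iff₀ hc]; linarith
            have h7 : 0 ≤ 4 * C * R * ρ := by positivity
            rw [hC3]; linarith
          · push Not at hsm
            have h1 : 1 / 4 * ‖z‖ < (C * ρ * ‖z‖) * ‖z‖ := by linarith
            have h2 := lt_of_mul_lt_mul_right h1 hzn
            have h3 : C * ρ * ‖z‖ ≤ C * ρ * R := by gcongr
            have h7 : 0 ≤ 16 * C / c * ρ := by positivity
            rw [hC3]; linarith
        have : 0 ≤ C3 * ρ := by positivity
        gcongr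
      have h1 := hmin ‖z‖ hzn hzR
      have h2 : C3 * ρ * (2 * ‖z‖) ≤ C3 * ρ * (2 * (R * min ‖z‖ 1)) := by gcongr
      have h3 : 0 ≤ C * 4 * R ^ 2 * ρ * (‖y‖ * min ‖y - z‖ 1 / δ) := by positivity
      linarith
    · push Not at hcase
      have h1 : 1 - t ≤ C * ρ * ‖z‖ ^ 2 / δ := by rwa [le_div_iff₀ hδ0]
      have h2 : C * ρ * ‖z‖ ^ 2 ≤ C * ρ * (R * (2 * ‖y‖)) := by
        rw [sq]; gcongr
      have h3 := hmin ‖y - z‖ hyz0 hyzR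
      have h4 : (1 - t) * ‖y - z‖ ≤ C * ρ * (R * (2 * ‖y‖)) / δ * (R * min ‖y - z‖ 1) := by
        have : 1 - t ≤ C * ρ * (R * (2 * ‖y‖)) / δ := h1.trans (by gcongr)
        gcongr
      have h5 : C * ρ * (R * (2 * ‖y‖)) / δ * (R * min ‖y - z‖ 1)
          = C * 2 * R ^ 2 * ρ * (‖y‖ * min ‖y - z‖ 1 / δ) := by ring
      have h6 : 0 ≤ C * 2 * R ^ 2 * ρ * (‖y‖ * min ‖y - z‖ 1 / δ) := by positivity
      have h7 : 0 ≤ C3 * 2 * R * ρ * min ‖z‖ 1 := by positivity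
      linarith
  have habs : |‖L - (x' + A' z)‖ - ‖x - x'‖| ≤ ‖L - Z‖ + ‖A z - A' z‖ := by
    refine (abs_norm_sub_norm_le _ _).trans ?_
    have : L - (x' + A' z) - (x - x') = (L - Z) + (A z - A' z) := by rw [hZd]; abel
    rw [this]
    exact norm_add_le _ _
  have hm1 : 0 ≤ min ‖z‖ 1 := le_min hzn zero_le_one
  have hm2 : 0 ≤ min ‖y - z‖ 1 := le_min hyz0 zero_le_one
  have hqz : q * ‖z‖ ≤ ρ * (R * min ‖z‖ 1) := by
    have := hmin ‖z‖ hzn hzR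
    have : q ≤ ρ := by linarith
    gcongr
  set T := ‖y‖ * min ‖y - z‖ 1 / δ with hT
  have hT0 : 0 ≤ T := by positivity
  have k1 : 0 ≤ (R + C3 * 2 * R) * ρ * T := by positivity
  have k2 : 0 ≤ C * 4 * R ^ 2 * ρ * min ‖z‖ 1 := by positivity
  linarith


end helpers

/-- geometric inequalities (ii) and (iv): under Assumption (D) there is a
constant `C > 0` such that for all `x, x' ∈ ∂D`, `A ∈ I_x`, `A' ∈ I_{x'}`:
(ii) for `y, z` with `x+Ay ∈ D`, `x'+A'y ∈ D`, `x+Az ∉ D`, `x'+A'z ∈ D`,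
`| |Λ(x+Ay,x+Az) − (x'+A'z)| − |x−x'| |`
`  ≤ C ρ(x,x',A,A') (min(|z|,1) + |y| min(|y−z|,1) / δ(x+Ay))`;
(iv) for all `z`, `| |Λ(x,x+Az) − Λ(x',x'+A'z)| − |x−x'| | ≤ C`. -/
theorem stmt_15 (d : ℕ) (D : Set (EuclideanSpace ℝ (Fin d))) (ε₀ η : ℝ)
    (n : EuclideanSpace ℝ (Fin d) → EuclideanSpace ℝ (Fin d))
    (hD : AssumptionD d D ε₀ η n) :
    ∃ C : ℝ, 0 < C ∧
      ∀ x ∈ frontier D, ∀ x' ∈ frontier D,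
      ∀ A : EuclideanSpace ℝ (Fin d) →ₗᵢ[ℝ] EuclideanSpace ℝ (Fin d), A (e1 d) = n x →
      ∀ A' : EuclideanSpace ℝ (Fin d) →ₗᵢ[ℝ] EuclideanSpace ℝ (Fin d), A' (e1 d) = n x' →
        (∀ y z : EuclideanSpace ℝ (Fin d),
          x + A y ∈ D → x' + A' y ∈ D → x + A z ∉ D → x' + A' z ∈ D →
          |‖Lam D (x + A y) (x + A z) - (x' + A' z)‖ - ‖x - x'‖| ≤
            C * (‖x - x'‖ + ‖A.toContinuousLinearMap - A'.toContinuousLinearMap‖) *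
              (min ‖z‖ 1 + ‖y‖ * min ‖y - z‖ 1 /
                Metric.infDist (x + A y) (frontier D))) ∧
        (∀ z : EuclideanSpace ℝ (Fin d),
          |‖Lam D x (x + A z) - Lam D x' (x' + A' z)‖ - ‖x - x'‖| ≤ C) := by
  obtain ⟨C, hC, h2⟩ := aux_two hD
  obtain ⟨R, hR1, hR⟩ := aux_bound hD.isBounded
  refine ⟨C + R, by positivity, fun x hx x' hx' A hA A' hA' => ⟨?_, ?_⟩⟩
  · intro y z h1 h3 h4 h5
    refine (h2 x hx x' hx' A hA A' hA' y z h1 h3 h4 h5).trans ?_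
    have : 0 ≤ min ‖z‖ 1 := by positivity
    have : 0 ≤ min ‖y - z‖ 1 := by positivity
    have : 0 ≤ Metric.infDist (x + A y) (frontier D) := Metric.infDist_nonneg
    gcongr
    linarith
  · intro z
    have a1 := hR _ (aux_lam_mem D x (x + A z) hx.1).2 _ (aux_lam_mem D x' (x' + A' z) hx'.1).2
    have a2 := hR x hx.1 x' hx'.1
    change |‖(x + lamT D x (x + A z) • (x + A z - x)) - (x' + lamT D x' (x' + A' z) • (x' + A' z - x'))‖ - ‖x - x'‖| ≤ C + R
    rw [abs_le]
    constructor
    · linarith [norm_nonneg ((x + lamT D x (x + A z) • (x + A z - x)) - (x' + lamT D x' (x' + A' z) • (x' + A' z - x')))]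
    · linarith [norm_nonneg (x - x')]
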